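/- arXiv:2403.07229 — 2 statements merged into one kernel-verified Lean document; each statement's English description precedes it below -/
import Mathlib

section
/- Let A = M_{n_1}(ℂ) × ⋯ × M_{n_ℓ}(ℂ) and B = M_{m_1}(ℂ) × ⋯ × M_{m_{ℓ'}}(ℂ), and let φ : A → B be a unital completely positive map. Then the following are equivalent: (1) φ is a homomorphism; (2) for every positive integer p and every state μ on B ⊗ M_p(ℂ) (realized as Π_j M_{m_j·p}(ℂ) via Kronecker products), the adjusted entropies satisfy S̃(μ ∘ (φ ⊗ id)) ≤ S̃(μ), where φ ⊗ id : A ⊗ M_p(ℂ) → B ⊗ M_p(ℂ) is the unique linear map with (φ ⊗ id)(a ⊗ c) = φ(a) ⊗ c under these identifications. -/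
open scoped ComplexOrder Kronecker

/-- `H(x) = -∑ λᵢ log λᵢ`, the entropy of the eigenvalue list of a Hermitian matrix
(and `0` for non-Hermitian input). -/
noncomputable def entH {I : Type} [Fintype I] [DecidableEq I] (x : Matrix I I ℂ) : ℝ :=
  letI := Classical.propDecidable x.IsHermitian
  if hx : x.IsHermitian then -∑ i, (hx.eigenvalues i) * Real.log (hx.eigenvalues i) else 0

/-- Positivity in a product of matrix algebras. -/
def IsPos {ι : Type} {I : ι → Type} [∀ k, Fintype (I k)]
    (a : ∀ k, Matrix (I k) (I k) ℂ) : Prop := ∀ k, (a k).PosSemidef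

/-- The adjusted trace on a product of matrix algebras, with block weights `w`. -/
noncomputable def atr {ι : Type} [Fintype ι] {I : ι → Type} [∀ k, Fintype (I k)]
    (w : ι → ℕ) (a : ∀ k, Matrix (I k) (I k) ℂ) : ℂ :=
  ∑ k, (w k : ℂ) * (a k).trace

/-- The adjusted entropy `S̃ = ∑ w_k · H(d_k)` of an adjusted density operator `d`. -/
noncomputable def adjEnt {ι : Type} [Fintype ι] {I : ι → Type} [∀ k, Fintype (I k)]
    [∀ k, DecidableEq (I k)] (w : ι → ℕ) (d : ∀ k, Matrix (I k) (I k) ℂ) : ℝ :=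
  ∑ k, (w k : ℝ) * entH (d k)

/-- The `k`-th component of a `p×p` matrix over `Π k, M_{n k}(ℂ)`, viewed as a
`(p·n_k)×(p·n_k)` complex matrix. -/
def unblock {ι : Type} {I : ι → Type} {p : ℕ}
    (x : Matrix (Fin p) (Fin p) (∀ k, Matrix (I k) (I k) ℂ)) (k : ι) :
    Matrix (Fin p × I k) (Fin p × I k) ℂ :=
  Matrix.of fun a b => x a.1 b.1 k a.2 b.2

/-- Complete positivity of a map between products of matrix algebras. -/
def IsCP {ι κ : Type} [Fintype ι] [Fintype κ]
    {I : ι → Type} [∀ k, Fintype (I k)] [∀ k, DecidableEq (I k)]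
    {J : κ → Type} [∀ j, Fintype (J j)] [∀ j, DecidableEq (J j)]
    (φ : (∀ k, Matrix (I k) (I k) ℂ) →ₗ[ℂ] (∀ j, Matrix (J j) (J j) ℂ)) : Prop :=
  ∀ (p : ℕ) (x : Matrix (Fin p) (Fin p) (∀ k, Matrix (I k) (I k) ℂ)),
    (∀ k, (unblock x k).PosSemidef) → ∀ j, (unblock (x.map φ) j).PosSemidef

open Matrix in
/-- Entrywise form of the spectral theorem. -/
theorem Matrix.IsHermitian.apply_eq_sum {I : Type} [Fintype I] [DecidableEq I]
    {x : Matrix I I ℂ} (hx : x.IsHermitian) (a b : I) :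
    x a b = ∑ i, (hx.eigenvalues i : ℂ) *
      ((hx.eigenvectorUnitary : Matrix I I ℂ) a i *
        star ((hx.eigenvectorUnitary : Matrix I I ℂ) b i)) := by
  conv_lhs => rw [hx.spectral_theorem, Unitary.conjStarAlgAut_apply]
  simp only [Matrix.mul_apply, Matrix.diagonal_apply, Matrix.star_apply, mul_ite, mul_zero,
    Finset.sum_ite_eq', Finset.mem_univ, if_true, Function.comp]
  exact Finset.sum_congr rfl fun i _ => by simp only [Complex.coe_algebraMap]; ring

theorem sum_norm_sq_row_eq_one {I : Type} [Fintype I] [DecidableEq I]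
    (U : Matrix.unitaryGroup I ℂ) (a : I) : ∑ i, ‖(U : Matrix I I ℂ) a i‖ ^ 2 = 1 := by
  have h : ((U : Matrix I I ℂ) * star (U : Matrix I I ℂ)) a a = (1 : Matrix I I ℂ) a a := by
    rw [Matrix.mem_unitaryGroup_iff.mp U.2]
  simp only [Matrix.mul_apply, Matrix.star_apply, Matrix.one_apply_eq] at h
  have : ((∑ i, ‖(U : Matrix I I ℂ) a i‖ ^ 2 : ℝ) : ℂ) = 1 := by
    rw [← h]; push_cast
    exact Finset.sum_congr rfl fun i _ => (Complex.mul_conj' _).symm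
  exact_mod_cast this

theorem sum_norm_sq_col_eq_one {I : Type} [Fintype I] [DecidableEq I]
    (U : Matrix.unitaryGroup I ℂ) (i : I) : ∑ a, ‖(U : Matrix I I ℂ) a i‖ ^ 2 = 1 := by
  have h := sum_norm_sq_row_eq_one (star U) i
  simpa [Matrix.star_apply] using h

theorem entH_eq_sum_eigenvalues {I : Type} [Fintype I] [DecidableEq I] {x : Matrix I I ℂ}
    (hx : x.IsHermitian) : entH x = ∑ i, Real.negMulLog (hx.eigenvalues i) := by
  rw [entH, dif_pos hx, ← Finset.sum_neg_distrib]
  exact Finset.sum_congr rfl fun i _ => by simp [Real.negMulLog]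

theorem entH_eq_sum_roots {I : Type} [Fintype I] [DecidableEq I] {x : Matrix I I ℂ}
    (hx : x.IsHermitian) :
    entH x = (x.charpoly.roots.map fun z => Real.negMulLog z.re).sum := by
  rw [entH_eq_sum_eigenvalues hx, hx.roots_charpoly_eq_eigenvalues, Multiset.map_map]
  rfl

open Polynomial in
theorem entH_mul_conjTranspose {I S : Type} [Fintype I] [DecidableEq I] [Fintype S]
    [DecidableEq S] (W : Matrix I S ℂ) :
    entH (W * W.conjTranspose) = entH (W.conjTranspose * W) := by
  rw [entH_eq_sum_roots (Matrix.isHermitian_mul_conjTranspose_self W),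
    entH_eq_sum_roots (Matrix.isHermitian_conjTranspose_mul_self W)]
  have h := congrArg (fun q : ℂ[X] => (q.roots.map fun z => Real.negMulLog z.re).sum)
    (Matrix.charpoly_mul_comm' W W.conjTranspose)
  have key : ∀ (N : ℕ) (q : ℂ[X]), q.Monic →
      (((X : ℂ[X]) ^ N * q).roots.map fun z => Real.negMulLog z.re).sum
        = (q.roots.map fun z => Real.negMulLog z.re).sum := by
    intro N q hq
    rw [roots_mul (((monic_X_pow N).mul hq).ne_zero), roots_X_pow]
    simp [Multiset.map_nsmul, Multiset.sum_nsmul]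
  simpa only [key _ _ (Matrix.charpoly_monic _)] using h

theorem entH_diagonal {S : Type} [Fintype S] [DecidableEq S] (d : S → ℝ) :
    entH (Matrix.diagonal fun s => (d s : ℂ)) = ∑ s, Real.negMulLog (d s) := by
  rw [entH_eq_sum_roots (Matrix.isHermitian_diagonal_of_self_adjoint _ (by ext s; simp)),
    Matrix.charpoly_diagonal, Polynomial.roots_prod _ _
      (Finset.prod_ne_zero_iff.mpr fun s _ => Polynomial.X_sub_C_ne_zero _)]
  simp

/-- The entropy of a positive semidefinite matrix is at most that of its diagonal. -/
theorem entH_le_sum_diag {S : Type} [Fintype S] [DecidableEq S] {x : Matrix S S ℂ}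
    (hx : x.PosSemidef) : entH x ≤ ∑ s, Real.negMulLog (x s s).re := by
  rw [entH_eq_sum_eigenvalues hx.1]
  set U := hx.1.eigenvectorUnitary with hU
  have hdiag : ∀ s, (x s s).re = ∑ i, ‖(U : Matrix S S ℂ) s i‖ ^ 2 * hx.1.eigenvalues i := by
    intro s
    rw [hx.1.apply_eq_sum s s, Complex.re_sum]
    refine Finset.sum_congr rfl fun i _ => ?_
    have : (U : Matrix S S ℂ) s i * star ((U : Matrix S S ℂ) s i)
        = ((‖(U : Matrix S S ℂ) s i‖ ^ 2 : ℝ) : ℂ) := by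
      push_cast; exact Complex.mul_conj' _
    rw [← hU, this, ← Complex.ofReal_mul, Complex.ofReal_re, mul_comm]
  calc ∑ i, Real.negMulLog (hx.1.eigenvalues i)
      = ∑ i, (∑ s, ‖(U : Matrix S S ℂ) s i‖ ^ 2) * Real.negMulLog (hx.1.eigenvalues i) := by
        simp [sum_norm_sq_col_eq_one]
    _ = ∑ s, ∑ i, ‖(U : Matrix S S ℂ) s i‖ ^ 2 * Real.negMulLog (hx.1.eigenvalues i) := by
        simp_rw [Finset.sum_mul]; exact Finset.sum_comm
    _ ≤ ∑ s, Real.negMulLog (x s s).re := by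
        refine Finset.sum_le_sum fun s _ => ?_
        rw [hdiag s]
        simpa only [smul_eq_mul] using Real.concaveOn_negMulLog.le_map_sum
          (t := Finset.univ) (w := fun i => ‖(U : Matrix S S ℂ) s i‖ ^ 2)
          (p := hx.1.eigenvalues) (fun i _ => by positivity)
          (sum_norm_sq_row_eq_one U s) (fun i _ => hx.eigenvalues_nonneg i)

open Matrix in
theorem sum_smul_vecMulVec_eq_mul {I S : Type} [Fintype S] (c : S → ℝ)
    (hc : ∀ s, 0 ≤ c s) (w : S → I → ℂ) :
    ∑ s, (c s : ℂ) • vecMulVec (w s) (star (w s)) =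
      (Matrix.of fun a s => (√(c s) : ℂ) * w s a) *
        (Matrix.of fun a s => (√(c s) : ℂ) * w s a).conjTranspose := by
  ext a b
  simp only [Matrix.sum_apply, Matrix.smul_apply, vecMulVec_apply, Matrix.mul_apply,
    conjTranspose_apply, of_apply, Pi.star_apply, star_mul', smul_eq_mul]
  refine Finset.sum_congr rfl fun s _ => ?_
  have : (c s : ℂ) = (√(c s) : ℂ) * (√(c s) : ℂ) := by
    rw [← Complex.ofReal_mul, Real.mul_self_sqrt (hc s)]
  rw [this, Complex.star_def, Complex.conj_ofReal]; ring

open Matrix in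
theorem scaledGram_apply {I S : Type} [Fintype I] (c : S → ℝ) (w : S → I → ℂ) (s t : S) :
    ((Matrix.of fun a s => (√(c s) : ℂ) * w s a).conjTranspose *
      (Matrix.of fun a s => (√(c s) : ℂ) * w s a)) s t =
      (√(c s) * √(c t) : ℂ) * (star (w s) ⬝ᵥ w t) := by
  simp only [Matrix.mul_apply, conjTranspose_apply, of_apply, star_mul', dotProduct,
    Finset.mul_sum, Pi.star_apply, Complex.star_def, Complex.conj_ofReal]
  exact Finset.sum_congr rfl fun _ _ => by ring

open Matrix in
theorem star_dotProduct_self_eq {I : Type} [Fintype I] (w : I → ℂ) :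
    star w ⬝ᵥ w = ((∑ a, ‖w a‖ ^ 2 : ℝ) : ℂ) := by
  simp only [dotProduct, Pi.star_apply]; push_cast
  exact Finset.sum_congr rfl fun i _ => Complex.conj_mul' _

open Matrix in
theorem scaledGram_apply_self {I S : Type} [Fintype I] (c : S → ℝ)
    (hc : ∀ s, 0 ≤ c s) (w : S → I → ℂ) (s : S) :
    ((Matrix.of fun a s => (√(c s) : ℂ) * w s a).conjTranspose *
      (Matrix.of fun a s => (√(c s) : ℂ) * w s a)) s s =
      ((c s * ∑ a, ‖w s a‖ ^ 2 : ℝ) : ℂ) := by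
  rw [scaledGram_apply, star_dotProduct_self_eq, ← Complex.ofReal_mul, Real.mul_self_sqrt (hc s),
    Complex.ofReal_mul]

open Matrix in
/-- The entropy of a positive combination of rank-one matrices is bounded by the entropy of the
list of their traces. -/
theorem entH_sum_smul_vecMulVec_le {I S : Type} [Fintype I] [DecidableEq I] [Fintype S]
    (c : S → ℝ) (hc : ∀ s, 0 ≤ c s) (w : S → I → ℂ) :
    entH (∑ s, (c s : ℂ) • vecMulVec (w s) (star (w s))) ≤
      ∑ s, Real.negMulLog (c s * ∑ a, ‖w s a‖ ^ 2) := by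
  classical
  rw [sum_smul_vecMulVec_eq_mul c hc w, entH_mul_conjTranspose]
  refine (entH_le_sum_diag (posSemidef_conjTranspose_mul_self _)).trans_eq ?_
  exact Finset.sum_congr rfl fun s _ => by rw [scaledGram_apply_self c hc, Complex.ofReal_re]

open Matrix in
theorem entH_sum_smul_vecMulVec_of_orthogonal {I S : Type} [Fintype I] [DecidableEq I] [Fintype S]
    (c : S → ℝ) (hc : ∀ s, 0 ≤ c s) (w : S → I → ℂ)
    (hw : Pairwise fun s t => star (w s) ⬝ᵥ w t = 0) :
    entH (∑ s, (c s : ℂ) • vecMulVec (w s) (star (w s))) =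
      ∑ s, Real.negMulLog (c s * ∑ a, ‖w s a‖ ^ 2) := by
  classical
  rw [sum_smul_vecMulVec_eq_mul c hc w, entH_mul_conjTranspose, ← entH_diagonal]
  congr 1
  ext s t
  rcases eq_or_ne s t with rfl | hst
  · rw [scaledGram_apply_self c hc, diagonal_apply_eq]
  · rw [scaledGram_apply, hw hst, diagonal_apply_ne _ hst, mul_zero]

theorem entH_zero {I : Type} [Fintype I] [DecidableEq I] : entH (0 : Matrix I I ℂ) = 0 := by
  simpa using entH_diagonal (S := I) fun _ => 0

/-- The squared Hilbert–Schmidt norm of a matrix. -/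
noncomputable def hsSq {M I : Type} [Fintype M] [Fintype I] (V : Matrix M I ℂ) : ℝ :=
  ∑ a, ∑ b, ‖V a b‖ ^ 2

open Matrix in
theorem trace_conjTranspose_mul_self_eq_hsSq {M I : Type} [Fintype M] [Fintype I]
    (V : Matrix M I ℂ) : (Vᴴ * V).trace = (hsSq V : ℂ) := by
  rw [hsSq, Finset.sum_comm]
  simp only [trace, diag_apply, Matrix.mul_apply, conjTranspose_apply]
  push_cast
  exact Finset.sum_congr rfl fun i _ => Finset.sum_congr rfl fun j _ => Complex.conj_mul' _

theorem hsSq_nonneg {M I : Type} [Fintype M] [Fintype I] (V : Matrix M I ℂ) : 0 ≤ hsSq V := by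
  unfold hsSq; positivity

open Matrix in
theorem hsSq_eq_zero {M I : Type} [Fintype M] [Fintype I] {V : Matrix M I ℂ} :
    hsSq V = 0 ↔ V = 0 := by
  rw [← trace_conjTranspose_mul_self_eq_zero_iff, trace_conjTranspose_mul_self_eq_hsSq,
    Complex.ofReal_eq_zero]

open Matrix in
theorem eq_zero_of_sum_conjTranspose_mul_self_eq_zero {S M : Type} {I : S → Type} [Fintype M]
    [∀ s, Fintype (I s)] (F : Finset S) (T : ∀ s, Matrix (I s) M ℂ)
    (h : ∑ s ∈ F, (T s)ᴴ * T s = 0) : ∀ s ∈ F, T s = 0 := by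
  have h' := congrArg trace h
  simp only [trace_sum, trace_conjTranspose_mul_self_eq_hsSq, trace_zero] at h'
  rw [← Complex.ofReal_sum, Complex.ofReal_eq_zero,
    Finset.sum_eq_zero_iff_of_nonneg fun s _ => hsSq_nonneg _] at h'
  exact fun s hs => hsSq_eq_zero.mp (h' s hs)

section Kraus

open Matrix

variable {ι M : Type} [Fintype ι] {I : ι → Type} [∀ k, Fintype (I k)]
  {R : ι → Type} [∀ k, Fintype (R k)]

/-- The map `x ↦ ∑ V_s x V_sᴴ` on a product of matrix algebras, where each Kraus operator `V_s`
acts on one block. -/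
noncomputable def krausMap (V : ∀ s : Σ k, R k, Matrix M (I s.1) ℂ)
    (x : ∀ k, Matrix (I k) (I k) ℂ) : Matrix M M ℂ :=
  ∑ s, V s * x s.1 * (V s)ᴴ

variable {V : ∀ s : Σ k, R k, Matrix M (I s.1) ℂ}

theorem krausMap_conjTranspose (x : ∀ k, Matrix (I k) (I k) ℂ) :
    krausMap V (fun k => (x k)ᴴ) = (krausMap V x)ᴴ := by
  simp [krausMap, conjTranspose_sum, Matrix.mul_assoc]

variable [∀ k, DecidableEq (I k)]

theorem krausMap_one_eq : krausMap V 1 = ∑ s, V s * (V s)ᴴ := by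
  simp [krausMap]

variable [Fintype M] [DecidableEq M]

theorem conjTranspose_mul_self_eq_sum_of_unital (h1 : krausMap V 1 = 1) (s : Σ k, R k) :
    (V s)ᴴ * V s = ∑ t, ((V t)ᴴ * V s)ᴴ * ((V t)ᴴ * V s) := by
  calc (V s)ᴴ * V s = (V s)ᴴ * krausMap V 1 * V s := by rw [h1, Matrix.mul_one]
    _ = _ := by
      simp [krausMap_one_eq, Matrix.mul_sum, Matrix.sum_mul, Matrix.mul_assoc]

theorem hsSq_one_sub_le_of_unital (h1 : krausMap V 1 = 1) (s : Σ k, R k) :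
    hsSq (1 - (V s)ᴴ * V s) ≤ Fintype.card (I s.1) - hsSq (V s) := by
  have h := congrArg trace (conjTranspose_mul_self_eq_sum_of_unital h1 s)
  rw [trace_sum] at h
  simp only [trace_conjTranspose_mul_self_eq_hsSq] at h
  rw [← Complex.ofReal_sum, Complex.ofReal_inj] at h
  have hle : hsSq ((V s)ᴴ * V s) ≤ hsSq (V s) := by
    rw [h]
    exact Finset.single_le_sum (f := fun t => hsSq ((V t)ᴴ * V s))
      (fun t _ => hsSq_nonneg _) (Finset.mem_univ s)
  have hex : ((hsSq (1 - (V s)ᴴ * V s) : ℝ) : ℂ)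
      = ((Fintype.card (I s.1) - 2 * hsSq (V s) + hsSq ((V s)ᴴ * V s) : ℝ) : ℂ) := by
    push_cast
    simp only [← trace_conjTranspose_mul_self_eq_hsSq, conjTranspose_sub, conjTranspose_one,
      conjTranspose_mul, conjTranspose_conjTranspose, Matrix.sub_mul, Matrix.mul_sub,
      Matrix.one_mul, Matrix.mul_one, trace_sub, trace_one]
    ring
  rw [Complex.ofReal_inj] at hex
  linarith

/-- A unital map whose nonzero Kraus operators are isometries is multiplicative. -/
theorem krausMap_mul_of_isometry (h1 : krausMap V 1 = 1)
    (hV : ∀ s, V s = 0 ∨ (V s)ᴴ * V s = 1) (x y : ∀ k, Matrix (I k) (I k) ℂ) :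
    krausMap V (x * y) = krausMap V x * krausMap V y := by
  classical
  have horth : ∀ s t, t ≠ s → (V t)ᴴ * V s = 0 := by
    intro s t hts
    rcases hV s with h0 | hs
    · rw [h0, Matrix.mul_zero]
    have h := conjTranspose_mul_self_eq_sum_of_unital h1 s
    rw [← Finset.add_sum_erase _ _ (Finset.mem_univ s), hs, conjTranspose_one, Matrix.mul_one,
      left_eq_add] at h
    exact eq_zero_of_sum_conjTranspose_mul_self_eq_zero _ (fun t => (V t)ᴴ * V s) h t
      (Finset.mem_erase.mpr ⟨hts, Finset.mem_univ t⟩)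
  simp only [krausMap, Matrix.sum_mul]
  refine Finset.sum_congr rfl fun s _ => ?_
  rw [Matrix.mul_sum, Finset.sum_eq_single s]
  · rcases hV s with h0 | hs
    · simp [h0]
    · calc V s * (x * y) s.1 * (V s)ᴴ
          = V s * x s.1 * (1 : Matrix (I s.1) (I s.1) ℂ) * (y s.1 * (V s)ᴴ) := by
            simp [Matrix.mul_assoc]
        _ = _ := by rw [← hs]; simp only [Matrix.mul_assoc]
  · intro t _ hts
    calc V s * x s.1 * (V s)ᴴ * (V t * y t.1 * (V t)ᴴ)
        = V s * x s.1 * ((V s)ᴴ * V t) * (y t.1 * (V t)ᴴ) := by simp only [Matrix.mul_assoc]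
      _ = 0 := by rw [horth t s hts.symm]; simp
  · simp

theorem conjTranspose_mul_krausMap_of_mul
    (hmul : ∀ x y, krausMap V (x * y) = krausMap V x * krausMap V y) (h1 : krausMap V 1 = 1)
    (x : ∀ k, Matrix (I k) (I k) ℂ) (s : Σ k, R k) :
    (V s)ᴴ * krausMap V x = x s.1 * (V s)ᴴ := by
  have key : ∑ s, ((V s)ᴴ * krausMap V x - x s.1 * (V s)ᴴ)ᴴ *
      ((V s)ᴴ * krausMap V x - x s.1 * (V s)ᴴ) = 0 := by
    have e : ∀ s, ((V s)ᴴ * krausMap V x - x s.1 * (V s)ᴴ)ᴴ *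
        ((V s)ᴴ * krausMap V x - x s.1 * (V s)ᴴ) =
        (krausMap V x)ᴴ * (V s * (V s)ᴴ) * krausMap V x
          - (krausMap V x)ᴴ * (V s * x s.1 * (V s)ᴴ)
          - (V s * (x s.1)ᴴ * (V s)ᴴ) * krausMap V x
          + V s * ((x s.1)ᴴ * x s.1) * (V s)ᴴ := by
      intro s
      simp only [conjTranspose_sub, conjTranspose_mul, conjTranspose_conjTranspose,
        Matrix.sub_mul, Matrix.mul_sub, Matrix.mul_assoc]
      abel
    simp only [e, Finset.sum_add_distrib, Finset.sum_sub_distrib, ← Matrix.mul_sum,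
      ← Matrix.sum_mul]
    rw [← krausMap_one_eq, h1, Matrix.mul_one]
    change (krausMap V x)ᴴ * krausMap V x - (krausMap V x)ᴴ * krausMap V x
      - krausMap V (fun k => (x k)ᴴ) * krausMap V x + krausMap V ((fun k => (x k)ᴴ) * x) = 0
    rw [hmul]
    abel
  exact sub_eq_zero.mp
    (eq_zero_of_sum_conjTranspose_mul_self_eq_zero Finset.univ
      (fun s => (V s)ᴴ * krausMap V x - x s.1 * (V s)ᴴ) key s (Finset.mem_univ s))

/-- If a unital map given by trace-orthogonal Kraus operators is multiplicative, then its nonzero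
Kraus operators are isometries. -/
theorem isometry_of_krausMap_mul [DecidableEq ι] [∀ k, Nonempty (I k)]
    (hmul : ∀ x y, krausMap V (x * y) = krausMap V x * krausMap V y) (h1 : krausMap V 1 = 1)
    (horth : ∀ k, Pairwise fun r r' : R k => ((V ⟨k, r⟩)ᴴ * V ⟨k, r'⟩).trace = 0)
    (s : Σ k, R k) : V s = 0 ∨ (V s)ᴴ * V s = 1 := by
  have hl := conjTranspose_mul_krausMap_of_mul hmul h1
  have hr : ∀ x t, krausMap V x * V t = V t * x t.1 := by
    intro x t
    have h := congrArg conjTranspose (hl (fun k => (x k)ᴴ) t)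
    simpa [krausMap_conjTranspose] using h
  have hcomm : ∀ (x : ∀ k, Matrix (I k) (I k) ℂ) (s t : Σ k, R k),
      x s.1 * ((V s)ᴴ * V t) = (V s)ᴴ * V t * x t.1 := by
    intro x s t
    rw [← Matrix.mul_assoc, ← hl, Matrix.mul_assoc, hr, Matrix.mul_assoc]
  have hscalar : ∀ k (r r' : R k), ∃ c : ℂ, (V ⟨k, r⟩)ᴴ * V ⟨k, r'⟩ = c • 1 := by
    intro k r r'
    obtain ⟨c, hc⟩ := mem_range_scalar_of_commute_single
      (M := (V ⟨k, r⟩)ᴴ * V ⟨k, r'⟩) fun i j _ => by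
        have h := hcomm (Pi.single k (single i j 1)) ⟨k, r⟩ ⟨k, r'⟩
        simpa [Commute, SemiconjBy] using h
    exact ⟨c, by rw [← hc, smul_one_eq_diagonal]; rfl⟩
  have hzero : ∀ s t, t ≠ s → (V t)ᴴ * V s = 0 := by
    rintro ⟨k, r⟩ ⟨k', r'⟩ hne
    rcases eq_or_ne k' k with rfl | hk
    · have hrr : r' ≠ r := fun h => hne (by rw [h])
      obtain ⟨c, hc⟩ := hscalar k' r' r
      have h : ((V ⟨k', r'⟩)ᴴ * V ⟨k', r⟩).trace = 0 := horth k' hrr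
      rw [hc, trace_smul, trace_one, smul_eq_mul, mul_eq_zero] at h
      rw [hc, h.resolve_right (by simp), zero_smul]
    · have h := hcomm (Pi.single k' 1) ⟨k', r'⟩ ⟨k, r⟩
      simpa [Pi.single_eq_of_ne hk.symm] using h
  obtain ⟨k, r⟩ := s
  obtain ⟨c, hc⟩ := hscalar k r r
  have hVV : V ⟨k, r⟩ = c • V ⟨k, r⟩ := by
    calc V ⟨k, r⟩ = krausMap V 1 * V ⟨k, r⟩ := by rw [h1, Matrix.one_mul]
      _ = ∑ t, V t * ((V t)ᴴ * V ⟨k, r⟩) := by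
        simp [krausMap_one_eq, Matrix.sum_mul, Matrix.mul_assoc]
      _ = V ⟨k, r⟩ * ((V ⟨k, r⟩)ᴴ * V ⟨k, r⟩) :=
        Finset.sum_eq_single _ (fun t _ ht => by rw [hzero _ _ ht, Matrix.mul_zero]) (by simp)
      _ = c • V ⟨k, r⟩ := by rw [hc]; simp
  have h : (1 - c) • V ⟨k, r⟩ = 0 := by rw [sub_smul, one_smul, ← hVV, sub_self]
  rcases smul_eq_zero.mp h with h | h
  · right
    rw [hc, ← sub_eq_zero.mp h, one_smul]
  · exact Or.inl h

end Kraus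

open Matrix in
/-- A completely positive map between products of matrix algebras has, at each block of the target,
a Kraus representation by operators that are trace-orthogonal within each block of the source. -/
theorem IsCP.exists_kraus {ℓ ℓ' : ℕ} {n : Fin ℓ → ℕ} {m : Fin ℓ' → ℕ}
    {φ : (∀ k, Matrix (Fin (n k)) (Fin (n k)) ℂ) →ₗ[ℂ] (∀ j, Matrix (Fin (m j)) (Fin (m j)) ℂ)}
    (hφ : IsCP φ) (j : Fin ℓ') :
    ∃ V : ∀ s : Σ k, Fin (n k) × Fin (m j), Matrix (Fin (m j)) (Fin (n s.1)) ℂ,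
      (∀ x, φ x j = krausMap V x) ∧
      ∀ k, Pairwise fun r r' => ((V ⟨k, r⟩)ᴴ * V ⟨k, r'⟩).trace = 0 := by
  let E : ∀ k, Matrix (Fin (n k)) (Fin (n k)) (∀ k, Matrix (Fin (n k)) (Fin (n k)) ℂ) :=
    fun k => Matrix.of fun a b => Pi.single k (single a b 1)
  have hC : ∀ k, (unblock ((E k).map φ) j).PosSemidef := by
    intro k
    refine hφ (n k) (E k) (fun k' => ?_) j
    rcases eq_or_ne k' k with rfl | hk
    · convert posSemidef_vecMulVec_self_star
        (fun z : Fin (n k') × Fin (n k') => if z.1 = z.2 then (1 : ℂ) else 0) using 1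
      ext ⟨a, s⟩ ⟨b, t⟩
      by_cases h1 : a = s <;> by_cases h2 : b = t <;>
        simp [unblock, E, vecMulVec_apply, single, h1, h2]
    · convert PosSemidef.zero using 1
      ext ⟨a, s⟩ ⟨b, t⟩
      simp [unblock, E, Pi.single_eq_of_ne hk]
  let U : ∀ k, Matrix (Fin (n k) × Fin (m j)) (Fin (n k) × Fin (m j)) ℂ :=
    fun k => ((hC k).1.eigenvectorUnitary : Matrix _ _ ℂ)
  let V : ∀ s : Σ k, Fin (n k) × Fin (m j), Matrix (Fin (m j)) (Fin (n s.1)) ℂ :=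
    fun s => Matrix.of fun t a => (√((hC s.1).1.eigenvalues s.2) : ℂ) * U s.1 (a, t) s.2
  refine ⟨V, fun x => ?_, fun k r r' hrr => ?_⟩
  · have hsum : x = ∑ k, ∑ a, ∑ b, x k a b • E k a b := by
      ext k a b
      simp only [E, Finset.sum_apply, Matrix.sum_apply, of_apply, Pi.smul_apply,
        Matrix.smul_apply]
      rw [Finset.sum_eq_single k]
      · simp [single_apply, ite_and]
      · intro k' _ hk
        simp [Pi.single_eq_of_ne hk.symm]
      · simp
    ext s t
    conv_lhs => rw [hsum]
    simp only [map_sum, map_smul, Finset.sum_apply, Matrix.sum_apply, Pi.smul_apply,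
      Matrix.smul_apply, krausMap, Fintype.sum_sigma, smul_eq_mul]
    refine Finset.sum_congr rfl fun k _ => ?_
    have hentry : ∀ a b, φ (E k a b) j s t =
        ∑ r, V ⟨k, r⟩ s a * star (V ⟨k, r⟩ t b) := by
      intro a b
      refine ((hC k).1.apply_eq_sum (a, s) (b, t)).trans (Finset.sum_congr rfl fun r _ => ?_)
      have : ((hC k).1.eigenvalues r : ℂ) =
          (√((hC k).1.eigenvalues r) : ℂ) * (√((hC k).1.eigenvalues r) : ℂ) := by
        rw [← Complex.ofReal_mul, Real.mul_self_sqrt ((hC k).eigenvalues_nonneg r)]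
      simp only [V, U, of_apply, star_mul', Complex.star_def, Complex.conj_ofReal, this]
      ring
    simp only [hentry, Matrix.mul_apply, conjTranspose_apply, Finset.mul_sum, Finset.sum_mul]
    calc ∑ a, ∑ b, ∑ r, x k a b * (V ⟨k, r⟩ s a * star (V ⟨k, r⟩ t b))
        = ∑ a, ∑ r, ∑ b, x k a b * (V ⟨k, r⟩ s a * star (V ⟨k, r⟩ t b)) :=
          Finset.sum_congr rfl fun a _ => Finset.sum_comm
      _ = ∑ r, ∑ a, ∑ b, x k a b * (V ⟨k, r⟩ s a * star (V ⟨k, r⟩ t b)) := Finset.sum_comm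
      _ = ∑ r, ∑ b, ∑ a, x k a b * (V ⟨k, r⟩ s a * star (V ⟨k, r⟩ t b)) :=
          Finset.sum_congr rfl fun r _ => Finset.sum_comm
      _ = _ := Finset.sum_congr rfl fun r _ => Finset.sum_congr rfl fun b _ =>
          Finset.sum_congr rfl fun a _ => by ring
  · have h : (star (U k) * U k) r r' = 0 := by
      rw [Matrix.mem_unitaryGroup_iff'.mp (hC k).1.eigenvectorUnitary.2, one_apply_ne hrr]
    have e : ((V ⟨k, r⟩)ᴴ * V ⟨k, r'⟩).trace =
        (√((hC k).1.eigenvalues r) * √((hC k).1.eigenvalues r') : ℂ) * (star (U k) * U k) r r' := by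
      simp only [trace, diag_apply, Matrix.mul_apply, conjTranspose_apply, star_apply,
        Fintype.sum_prod_type, Finset.mul_sum, V, of_apply, star_mul', Complex.star_def,
        Complex.conj_ofReal]
      exact Finset.sum_congr rfl fun a _ => Finset.sum_congr rfl fun t _ => by ring
    exact e.trans (by rw [h, mul_zero])

section Entropy

open Matrix

variable {ι M : Type} [Fintype ι] {I : ι → Type} [∀ k, Fintype (I k)]
  {R : ι → Type} [∀ k, Fintype (R k)] [Fintype M]

theorem trace_vecMulVec_star {K : Type} [Fintype K] (w : K → ℂ) :
    (vecMulVec w (star w)).trace = ((∑ a, ‖w a‖ ^ 2 : ℝ) : ℂ) := by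
  rw [trace_vecMulVec, dotProduct_comm, star_dotProduct_self_eq]

theorem trace_krausMap_mul_vecMulVec (V : ∀ s : Σ k, R k, Matrix M (I s.1) ℂ)
    (x : ∀ k, Matrix (I k) (I k) ℂ) (v : M → ℂ) :
    (krausMap V x * vecMulVec v (star v)).trace =
      ∑ k, ∑ r, (x k * vecMulVec ((V ⟨k, r⟩)ᴴ *ᵥ v) (star ((V ⟨k, r⟩)ᴴ *ᵥ v))).trace := by
  rw [krausMap, Matrix.sum_mul, trace_sum, Fintype.sum_sigma]
  refine Finset.sum_congr rfl fun k _ => Finset.sum_congr rfl fun r _ => ?_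
  rw [star_mulVec, conjTranspose_conjTranspose, ← mul_vecMulVec, ← vecMulVec_mul,
    Matrix.mul_assoc, Matrix.mul_assoc, trace_mul_comm]
  simp only [Matrix.mul_assoc]

variable [∀ k, DecidableEq (I k)] [DecidableEq M]

theorem sum_norm_sq_conjTranspose_mulVec {V : ∀ s : Σ k, R k, Matrix M (I s.1) ℂ}
    (h1 : krausMap V 1 = 1) (v : M → ℂ) :
    ∑ s, ∑ a, ‖((V s)ᴴ *ᵥ v) a‖ ^ 2 = ∑ a, ‖v a‖ ^ 2 := by
  have h := trace_krausMap_mul_vecMulVec V 1 v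
  simp only [h1, Matrix.one_mul, Pi.one_apply, trace_vecMulVec_star] at h
  rw [← Fintype.sum_sigma (fun s : Σ k, R k => ((∑ a, ‖((V s)ᴴ *ᵥ v) a‖ ^ 2 : ℝ) : ℂ)),
    ← Complex.ofReal_sum, Complex.ofReal_inj] at h
  exact h.symm

theorem sum_hsSq_eq_card {V : ∀ s : Σ k, R k, Matrix M (I s.1) ℂ} (h1 : krausMap V 1 = 1) :
    ∑ s, hsSq (V s) = Fintype.card M := by
  have h := congrArg trace h1
  rw [krausMap_one_eq, trace_sum, trace_one] at h
  simp only [trace_mul_comm _ (_ᴴ), trace_conjTranspose_mul_self_eq_hsSq] at h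
  exact_mod_cast h

theorem sum_card_mul_negMulLog_le [∀ k, Nonempty (I k)] [Nonempty M]
    {V : ∀ s : Σ k, R k, Matrix M (I s.1) ℂ}
    (h1 : krausMap V 1 = 1) (hV : ∀ s, V s = 0 ∨ (V s)ᴴ * V s = 1) (v : M → ℂ) {c : ℝ}
    (hc : 0 ≤ c) :
    ∑ s : Σ k, R k, (Fintype.card (I s.1) : ℝ) *
        Real.negMulLog (Fintype.card M * c / Fintype.card (I s.1) *
          ∑ a, ‖((V s)ᴴ *ᵥ v) a‖ ^ 2) ≤
      Fintype.card M * Real.negMulLog (c * ∑ a, ‖v a‖ ^ 2) := by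
  have hM : (0 : ℝ) < Fintype.card M := by exact_mod_cast Fintype.card_pos
  have hI : ∀ k, (0 : ℝ) < Fintype.card (I k) := fun k => by exact_mod_cast Fintype.card_pos
  set t : (Σ k, R k) → ℝ := fun s => ∑ a, ‖((V s)ᴴ *ᵥ v) a‖ ^ 2 with ht
  have ht0 : ∀ s, 0 ≤ t s := fun s => by simp only [ht]; positivity
  have hcase : ∀ s, t s = 0 ∨ hsSq (V s) = Fintype.card (I s.1) := by
    intro s
    rcases hV s with h | h
    · left; simp [ht, h]
    · right
      have h' := congrArg trace h
      rw [trace_conjTranspose_mul_self_eq_hsSq, trace_one] at h'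
      exact_mod_cast h'
  have hJ := Real.concaveOn_negMulLog.le_map_sum (t := Finset.univ)
    (w := fun s : Σ k, R k => hsSq (V s) / Fintype.card M)
    (p := fun s => Fintype.card M * c / Fintype.card (I s.1) * t s)
    (fun s _ => div_nonneg (hsSq_nonneg _) hM.le)
    (by rw [← Finset.sum_div, sum_hsSq_eq_card h1, div_self hM.ne'])
    (fun s _ => Set.mem_Ici.mpr (mul_nonneg (by positivity) (ht0 s)))
  simp only [smul_eq_mul] at hJ
  have e1 : ∑ s, hsSq (V s) / Fintype.card M * (Fintype.card M * c / Fintype.card (I s.1) * t s)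
      = c * ∑ a, ‖v a‖ ^ 2 := by
    rw [← sum_norm_sq_conjTranspose_mulVec h1 v, Finset.mul_sum]
    refine Finset.sum_congr rfl fun s _ => ?_
    change _ = c * t s
    have := (hI s.1).ne'
    rcases hcase s with h | h
    · rw [h]; ring
    · rw [h]; field_simp
  rw [e1] at hJ
  refine le_trans (le_of_eq ?_) (mul_le_mul_of_nonneg_left hJ hM.le)
  rw [Finset.mul_sum]
  refine Finset.sum_congr rfl fun s _ => ?_
  rcases hcase s with h | h
  · simp [h, show ∑ a, ‖((V s)ᴴ *ᵥ v) a‖ ^ 2 = 0 from h]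
  · rw [h, ← mul_assoc, mul_div_cancel₀ _ (ne_of_gt hM)]

/-- If a unital map is given by isometric Kraus operators, then pulling back states along it does
not increase the adjusted entropy. -/
theorem adjEnt_le_of_isometry [DecidableEq ι] [∀ k, Nonempty (I k)] {κ : Type} [Fintype κ]
    {J : κ → Type} [∀ j, Fintype (J j)] [∀ j, DecidableEq (J j)] [∀ j, Nonempty (J j)]
    {R : κ → ι → Type} [∀ j k, Fintype (R j k)]
    {V : ∀ j, ∀ s : Σ k, R j k, Matrix (J j) (I s.1) ℂ}
    (h1 : ∀ j, krausMap (V j) 1 = 1) (hV : ∀ j s, V j s = 0 ∨ (V j s)ᴴ * V j s = 1)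
    {dν : ∀ k, Matrix (I k) (I k) ℂ} {dμ : ∀ j, Matrix (J j) (J j) ℂ} (hdμ : IsPos dμ)
    (h : ∀ x, atr (fun k => Fintype.card (I k)) (x * dν) =
      atr (fun j => Fintype.card (J j)) ((fun j => krausMap (V j) x) * dμ)) :
    adjEnt (fun k => Fintype.card (I k)) dν ≤ adjEnt (fun j => Fintype.card (J j)) dμ := by
  have hI : ∀ k, (0 : ℝ) < Fintype.card (I k) := fun k => by exact_mod_cast Fintype.card_pos
  let lam : ∀ j, J j → ℝ := fun j => (hdμ j).1.eigenvalues
  have hlam : ∀ j i, 0 ≤ lam j i := fun j => (hdμ j).eigenvalues_nonneg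
  let v : ∀ j, J j → J j → ℂ :=
    fun j i a => ((hdμ j).1.eigenvectorUnitary : Matrix (J j) (J j) ℂ) a i
  have hv : ∀ j i, ∑ a, ‖v j i a‖ ^ 2 = 1 := fun j i => sum_norm_sq_col_eq_one _ i
  have hspec : ∀ j, dμ j = ∑ i, (lam j i : ℂ) • vecMulVec (v j i) (star (v j i)) := by
    intro j
    ext a b
    rw [(hdμ j).1.apply_eq_sum a b]
    simp [Matrix.sum_apply, vecMulVec_apply, lam, v]
  let w : ∀ k, (Σ j, R j k × J j) → I k → ℂ := fun k q => (V q.1 ⟨k, q.2.1⟩)ᴴ *ᵥ v q.1 q.2.2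
  let c : ∀ k, (Σ j, R j k × J j) → ℝ :=
    fun k q => Fintype.card (J q.1) * lam q.1 q.2.2 / Fintype.card (I k)
  have hc : ∀ k q, 0 ≤ c k q := fun k q => by
    have := hlam q.1 q.2.2
    positivity
  have hdν : ∀ k, dν k = ∑ q, (c k q : ℂ) • vecMulVec (w k q) (star (w k q)) := by
    intro k
    rw [ext_iff_trace_mul_left]
    intro y
    have hk : (Fintype.card (I k) : ℂ) ≠ 0 := by exact_mod_cast (hI k).ne'
    refine mul_left_cancel₀ hk ?_
    have e := h (Pi.single k y)
    rw [atr, Finset.sum_eq_single k (fun k' _ hk' => by simp [Pi.single_eq_of_ne hk'])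
      (by simp)] at e
    simp only [Pi.mul_apply, Pi.single_eq_same, atr] at e
    rw [e, Matrix.mul_sum, trace_sum, Fintype.sum_sigma, Finset.mul_sum]
    refine Finset.sum_congr rfl fun j _ => ?_
    rw [hspec j, Matrix.mul_sum, trace_sum, Fintype.sum_prod_type_right, Finset.mul_sum,
      Finset.mul_sum]
    refine Finset.sum_congr rfl fun i _ => ?_
    rw [Matrix.mul_smul, trace_smul, trace_krausMap_mul_vecMulVec,
      Finset.sum_eq_single k (fun k' _ hk' => by simp [Pi.single_eq_of_ne hk']) (by simp)]
    simp only [Pi.single_eq_same, Finset.smul_sum, Finset.mul_sum]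
    refine Finset.sum_congr rfl fun r _ => ?_
    rw [Matrix.mul_smul, trace_smul]
    simp only [smul_eq_mul, c, w]
    push_cast
    field_simp
  calc adjEnt (fun k => Fintype.card (I k)) dν
      ≤ ∑ k, (Fintype.card (I k) : ℝ) *
          ∑ q, Real.negMulLog (c k q * ∑ a, ‖w k q a‖ ^ 2) := by
        refine Finset.sum_le_sum fun k _ => mul_le_mul_of_nonneg_left ?_ (hI k).le
        rw [hdν k]
        exact entH_sum_smul_vecMulVec_le _ (hc k) _
    _ = ∑ j, ∑ i, ∑ s : Σ k, R j k, (Fintype.card (I s.1) : ℝ) *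
          Real.negMulLog (Fintype.card (J j) * lam j i / Fintype.card (I s.1) *
            ∑ a, ‖((V j s)ᴴ *ᵥ v j i) a‖ ^ 2) := by
        simp only [Finset.mul_sum, Fintype.sum_sigma, Fintype.sum_prod_type_right]
        rw [Finset.sum_comm]
        exact Finset.sum_congr rfl fun j _ => Finset.sum_comm
    _ ≤ ∑ j, ∑ i, Fintype.card (J j) * Real.negMulLog (lam j i * ∑ a, ‖v j i a‖ ^ 2) :=
        Finset.sum_le_sum fun j _ => Finset.sum_le_sum fun i _ =>
          sum_card_mul_negMulLog_le (h1 j) (hV j) _ (hlam j i)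
    _ = adjEnt (fun j => Fintype.card (J j)) dμ := by
        refine Finset.sum_congr rfl fun j _ => ?_
        rw [entH_eq_sum_eigenvalues (hdμ j).1, Finset.mul_sum]
        simp only [hv, mul_one]
        rfl

end Entropy

section Amplification

open Matrix

variable {ι M : Type} {I R : ι → Type}

/-- The Kraus operators `V_s ⊗ 1` of the amplification of a map. -/
noncomputable def ampKraus (p : ℕ) (V : ∀ s : Σ k, R k, Matrix M (I s.1) ℂ) (s : Σ k, R k) :
    Matrix (M × Fin p) (I s.1 × Fin p) ℂ :=
  V s ⊗ₖ (1 : Matrix (Fin p) (Fin p) ℂ)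

theorem ampKraus_isometry [Fintype M] [∀ k, DecidableEq (I k)] (p : ℕ)
    {V : ∀ s : Σ k, R k, Matrix M (I s.1) ℂ} {s : Σ k, R k}
    (h : V s = 0 ∨ (V s)ᴴ * V s = 1) :
    ampKraus p V s = 0 ∨ (ampKraus p V s)ᴴ * ampKraus p V s = 1 := by
  rcases h with h | h
  · left; rw [ampKraus, h, zero_kronecker]
  · right
    rw [ampKraus, conjTranspose_kronecker, ← mul_kronecker_mul, h, conjTranspose_one,
      Matrix.mul_one, one_kronecker_one]

variable [Fintype ι] [∀ k, Fintype (I k)] [∀ k, Fintype (R k)]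

theorem krausMap_ampKraus_kronecker (p : ℕ) (V : ∀ s : Σ k, R k, Matrix M (I s.1) ℂ)
    (a : ∀ k, Matrix (I k) (I k) ℂ) (c : Matrix (Fin p) (Fin p) ℂ) :
    krausMap (I := fun k => I k × Fin p) (ampKraus p V) (fun k => a k ⊗ₖ c) =
      krausMap V a ⊗ₖ c := by
  simp only [krausMap, ampKraus, conjTranspose_kronecker, ← mul_kronecker_mul, conjTranspose_one,
    Matrix.one_mul, Matrix.mul_one]
  ext ⟨a, s⟩ ⟨b, t⟩
  simp [Matrix.sum_apply, kroneckerMap_apply, Finset.sum_mul]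

theorem krausMap_ampKraus_one [∀ k, DecidableEq (I k)] [DecidableEq M] (p : ℕ)
    {V : ∀ s : Σ k, R k, Matrix M (I s.1) ℂ} (h1 : krausMap V 1 = 1) :
    krausMap (I := fun k => I k × Fin p) (ampKraus p V) 1 = 1 := by
  have h := krausMap_ampKraus_kronecker p V 1 1
  rw [h1, one_kronecker_one] at h
  rw [← h]
  congr 1
  funext k
  exact one_kronecker_one.symm

/-- The map `krausMap V` as a linear map. -/
noncomputable def krausLinearMap (V : ∀ s : Σ k, R k, Matrix M (I s.1) ℂ) :
    (∀ k, Matrix (I k) (I k) ℂ) →ₗ[ℂ] Matrix M M ℂ where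
  toFun := krausMap V
  map_add' x y := by
    simp [krausMap, Matrix.mul_add, Matrix.add_mul, Finset.sum_add_distrib]
  map_smul' c x := by
    simp [krausMap, Finset.smul_sum]

/-- Linear maps out of an amplified product of matrix algebras agree when they agree on elementary
tensors. -/
theorem linearMap_eq_of_kronecker [DecidableEq ι] [∀ k, DecidableEq (I k)] {p : ℕ} {E : Type}
    [AddCommMonoid E] [Module ℂ E]
    {F G : (∀ k, Matrix (I k × Fin p) (I k × Fin p) ℂ) →ₗ[ℂ] E}
    (h : ∀ (a : ∀ k, Matrix (I k) (I k) ℂ) (c : Matrix (Fin p) (Fin p) ℂ),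
      F (fun k => a k ⊗ₖ c) = G (fun k => a k ⊗ₖ c)) : F = G := by
  refine LinearMap.pi_ext' fun k => Matrix.ext_linearMap _ fun i j => LinearMap.ext_ring ?_
  have e : (fun k' => (Pi.single k (single i.1 j.1 (1 : ℂ)) : ∀ k, Matrix (I k) (I k) ℂ) k' ⊗ₖ
      single i.2 j.2 (1 : ℂ)) = Pi.single k (single i j 1) := by
    funext k'
    rcases eq_or_ne k' k with rfl | hk
    · simp [single_kronecker_single]
    · simp [Pi.single_eq_of_ne hk]
  simpa [e] using h (Pi.single k (single i.1 j.1 1)) (single i.2 j.2 1)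

end Amplification

theorem eq_zero_or_eq_of_sum_negMulLog_le {S : Type} [Fintype S] {a N : S → ℝ} {m : ℝ}
    (hm : 0 < m) (ha : ∀ s, 0 ≤ a s) (haN : ∀ s, a s ≤ N s) (hN : ∀ s, 0 < N s)
    (hsum : ∑ s, a s = m)
    (h : ∑ s, N s * m * Real.negMulLog (a s / (N s * m ^ 2)) ≤
      m ^ 2 * Real.negMulLog (1 / m ^ 2)) (s : S) : a s = 0 ∨ a s = N s := by
  have hterm : ∀ s, N s * m * Real.negMulLog (a s / (N s * m ^ 2)) =
      N s / m * Real.negMulLog (a s / N s) + a s * (m * Real.negMulLog (1 / m ^ 2)) := by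
    intro s
    have := (hN s).ne'
    rw [show a s / (N s * m ^ 2) = a s / N s * (1 / m ^ 2) by field_simp, Real.negMulLog_mul]
    field_simp
  have hq : ∀ s, 0 ≤ N s / m * Real.negMulLog (a s / N s) := fun s =>
    mul_nonneg (div_nonneg (hN s).le hm.le) (Real.negMulLog_nonneg
      (div_nonneg (ha s) (hN s).le) ((div_le_one (hN s)).mpr (haN s)))
  simp only [hterm, Finset.sum_add_distrib, ← Finset.sum_mul, hsum] at h
  have h0 : ∑ s, N s / m * Real.negMulLog (a s / N s) = 0 :=
    le_antisymm (by nlinarith) (Finset.sum_nonneg fun s _ => hq s)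
  have hs := (Finset.sum_eq_zero_iff_of_nonneg fun s _ => hq s).mp h0 s (Finset.mem_univ s)
  have hNs := (hN s).ne'
  rcases mul_eq_zero.mp hs with h' | h'
  · exact absurd h' (div_ne_zero hNs hm.ne')
  rw [Real.negMulLog, mul_eq_zero, neg_eq_zero, Real.log_eq_zero] at h'
  have hnn := div_nonneg (ha s) (hN s).le
  rcases h' with h' | h' | h' | h'
  · exact Or.inl ((div_eq_zero_iff.mp h').resolve_right hNs)
  · exact Or.inl ((div_eq_zero_iff.mp h').resolve_right hNs)
  · exact Or.inr ((div_eq_one_iff_eq hNs).mp h')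
  · linarith

open Matrix in
/-- Testing the adjusted-entropy inequality on the maximally entangled vector forces
trace-orthogonal Kraus operators to be isometries. -/
theorem isometry_of_adjEnt_le {ℓ ℓ' : ℕ} {n : Fin ℓ → ℕ} {m : Fin ℓ' → ℕ}
    (hn : ∀ k, 0 < n k) (hm : ∀ j, 0 < m j)
    {V : ∀ j, ∀ s : Σ k, Fin (n k) × Fin (m j), Matrix (Fin (m j)) (Fin (n s.1)) ℂ}
    (j : Fin ℓ')
    (h1 : krausMap (I := fun k => Fin (n k)) (R := fun k => Fin (n k) × Fin (m j)) (V j) 1 = 1)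
    (horth : ∀ k, Pairwise fun r r' => ((V j ⟨k, r⟩)ᴴ * V j ⟨k, r'⟩).trace = 0)
    (h : ∀ μ : (∀ j', Matrix (Fin (m j') × Fin (m j)) (Fin (m j') × Fin (m j)) ℂ) →ₗ[ℂ] ℂ,
      μ 1 = 1 → (∀ b, IsPos b → 0 ≤ μ b) →
      ∀ dν : ∀ k, Matrix (Fin (n k) × Fin (m j)) (Fin (n k) × Fin (m j)) ℂ,
        IsPos dν → (∀ x, μ (fun j' => krausMap (I := fun k => Fin (n k) × Fin (m j))
          (R := fun k => Fin (n k) × Fin (m j'))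
            (ampKraus (I := fun k => Fin (n k)) (R := fun k => Fin (n k) × Fin (m j'))
          (m j) (V j')) x) =
          atr (fun k => n k * m j) (x * dν)) →
      ∀ dμ : ∀ j', Matrix (Fin (m j') × Fin (m j)) (Fin (m j') × Fin (m j)) ℂ,
        IsPos dμ → (∀ y, μ y = atr (fun j' => m j' * m j) (y * dμ)) →
        adjEnt (fun k => n k * m j) dν ≤ adjEnt (fun j' => m j' * m j) dμ)
    (s : Σ k, Fin (n k) × Fin (m j)) : V j s = 0 ∨ (V j s)ᴴ * V j s = 1 := by
  have hm0 : (0 : ℝ) < m j := by exact_mod_cast hm j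
  have hm0' : (m j : ℂ) ≠ 0 := by exact_mod_cast hm0.ne'
  have hn0 : ∀ k, (0 : ℝ) < n k := fun k => by exact_mod_cast hn k
  let v : Fin (m j) × Fin (m j) → ℂ := fun q => if q.1 = q.2 then 1 else 0
  have hv : ∑ q, ‖v q‖ ^ 2 = (m j : ℝ) := by
    rw [Fintype.sum_prod_type]
    simp [v, apply_ite]
  let w : ∀ k, Fin (n k) × Fin (m j) → Fin (n k) × Fin (m j) → ℂ :=
    fun k r => (ampKraus (I := fun k => Fin (n k)) (R := fun k => Fin (n k) × Fin (m j))
      (m j) (V j) ⟨k, r⟩)ᴴ *ᵥ v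
  have hw : ∀ k r q, w k r q = star (V j ⟨k, r⟩ q.2 q.1) := by
    rintro k r ⟨a, b⟩
    simp only [w, mulVec, dotProduct, Fintype.sum_prod_type, conjTranspose_apply, ampKraus, v,
      kroneckerMap_apply, one_apply, mul_ite, mul_one, mul_zero, Finset.sum_ite_eq,
      Finset.mem_univ, if_true]
    simp [apply_ite]
  have hwn : ∀ k r, ∑ q, ‖w k r q‖ ^ 2 = hsSq (V j ⟨k, r⟩) := by
    intro k r
    simp only [hw, norm_star, hsSq, Fintype.sum_prod_type_right]
  let c : ℝ := 1 / (m j : ℝ) ^ 3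
  have hc : 0 ≤ c := by positivity
  let dμ : ∀ j', Matrix (Fin (m j') × Fin (m j)) (Fin (m j') × Fin (m j)) ℂ :=
    Pi.single j ((c : ℂ) • vecMulVec v (star v))
  have hatr : ∀ y, atr (fun j' => m j' * m j) (y * dμ) =
      (m j : ℂ) ^ 2 * c * (y j * vecMulVec v (star v)).trace := by
    intro y
    rw [atr, Finset.sum_eq_single j (fun j' _ hj => by simp [dμ, Pi.single_eq_of_ne hj]) (by simp)]
    simp only [Pi.mul_apply, dμ, Pi.single_eq_same, Matrix.mul_smul, trace_smul, smul_eq_mul]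
    push_cast
    ring
  let μ : (∀ j', Matrix (Fin (m j') × Fin (m j)) (Fin (m j') × Fin (m j)) ℂ) →ₗ[ℂ] ℂ :=
    { toFun := fun y => atr (fun j' => m j' * m j) (y * dμ)
      map_add' := fun x y => by
        simp only [hatr, Pi.add_apply, Matrix.add_mul, trace_add]; ring
      map_smul' := fun z y => by
        simp only [hatr, Pi.smul_apply, Matrix.smul_mul, trace_smul, smul_eq_mul,
          RingHom.id_apply]
        ring }
  let dν : ∀ k, Matrix (Fin (n k) × Fin (m j)) (Fin (n k) × Fin (m j)) ℂ := fun k =>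
    ∑ r, ((1 / (n k * (m j : ℝ) ^ 2) : ℝ) : ℂ) • vecMulVec (w k r) (star (w k r))
  have hcn : ∀ k, (0 : ℝ) ≤ 1 / (n k * (m j : ℝ) ^ 2) := fun k => by positivity
  have hμ1 : μ 1 = 1 := by
    change atr _ (1 * dμ) = 1
    rw [hatr, Pi.one_apply, Matrix.one_mul, trace_vecMulVec_star, hv]
    simp only [c]
    push_cast
    field_simp
  have hμpos : ∀ b, IsPos b → 0 ≤ μ b := by
    intro b hb
    change 0 ≤ atr _ (b * dμ)
    rw [hatr, mul_vecMulVec, trace_vecMulVec, dotProduct_comm]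
    refine mul_nonneg ?_ ((hb j).dotProduct_mulVec_nonneg v)
    exact_mod_cast mul_nonneg (by positivity : (0 : ℝ) ≤ (m j : ℝ) ^ 2) hc
  have hdν : IsPos dν := fun k => posSemidef_sum _ fun r _ =>
    (posSemidef_vecMulVec_self_star _).smul (by exact_mod_cast hcn k)
  have hdμ : IsPos dμ := by
    intro j'
    rcases eq_or_ne j' j with rfl | hj
    · simp only [dμ, Pi.single_eq_same]
      exact (posSemidef_vecMulVec_self_star _).smul (by exact_mod_cast hc)
    · simp only [dμ, Pi.single_eq_of_ne hj]
      exact PosSemidef.zero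
  have hνeq : ∀ x, μ (fun j' => krausMap (I := fun k => Fin (n k) × Fin (m j))
      (R := fun k => Fin (n k) × Fin (m j'))
        (ampKraus (I := fun k => Fin (n k)) (R := fun k => Fin (n k) × Fin (m j'))
          (m j) (V j')) x) =
      atr (fun k => n k * m j) (x * dν) := by
    intro x
    change atr _ (_ * dμ) = _
    rw [hatr, trace_krausMap_mul_vecMulVec, atr, Finset.mul_sum]
    refine Finset.sum_congr rfl fun k _ => ?_
    have hk : (n k : ℂ) ≠ 0 := by exact_mod_cast (hn0 k).ne'
    simp only [Pi.mul_apply, dν, trace_sum, Finset.mul_sum, Matrix.mul_smul,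
      trace_smul, smul_eq_mul]
    refine Finset.sum_congr rfl fun r _ => ?_
    simp only [c, w]
    push_cast
    field_simp
  have hent := h μ hμ1 hμpos dν hdν hνeq dμ hdμ fun y => rfl
  have hentν : adjEnt (fun k => n k * m j) dν = ∑ s : Σ k, Fin (n k) × Fin (m j),
      (n s.1 : ℝ) * m j * Real.negMulLog (hsSq (V j s) / (n s.1 * (m j : ℝ) ^ 2)) := by
    rw [adjEnt, Fintype.sum_sigma]
    refine Finset.sum_congr rfl fun k _ => ?_
    rw [entH_sum_smul_vecMulVec_of_orthogonal (fun _ => 1 / (n k * (m j : ℝ) ^ 2))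
      (fun _ => hcn k) (w k), Finset.mul_sum]
    · refine Finset.sum_congr rfl fun r _ => ?_
      rw [hwn]
      push_cast
      congr 2
      ring
    · intro r r' hrr
      have h' : ((V j ⟨k, r'⟩)ᴴ * V j ⟨k, r⟩).trace = 0 := horth k hrr.symm
      rw [← h']
      simp only [dotProduct, Pi.star_apply, hw, star_star, trace, diag_apply, Matrix.mul_apply,
        conjTranspose_apply, Fintype.sum_prod_type]
      exact Finset.sum_congr rfl fun a _ => Finset.sum_congr rfl fun b _ => mul_comm _ _
  have hentμ : adjEnt (fun j' => m j' * m j) dμ ≤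
      (m j : ℝ) ^ 2 * Real.negMulLog (1 / (m j : ℝ) ^ 2) := by
    rw [adjEnt, Finset.sum_eq_single j
      (fun j' _ hj => by simp [dμ, Pi.single_eq_of_ne hj, entH_zero]) (by simp)]
    have hle := entH_sum_smul_vecMulVec_le (S := Unit) (fun _ => c) (fun _ => hc) (fun _ => v)
    simp only [Finset.univ_unique, Finset.sum_singleton, hv] at hle
    have hcm : c * m j = 1 / (m j : ℝ) ^ 2 := by simp only [c]; field_simp
    rw [hcm] at hle
    simp only [dμ, Pi.single_eq_same]
    push_cast
    rw [← pow_two]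
    exact mul_le_mul_of_nonneg_left hle (by positivity)
  have hle : ∀ s, hsSq (V j s) ≤ n s.1 := fun s => by
    have h' := hsSq_one_sub_le_of_unital h1 s
    have h'' := hsSq_nonneg (1 - (V j s)ᴴ * V j s)
    rw [Fintype.card_fin] at h'
    linarith
  rcases eq_zero_or_eq_of_sum_negMulLog_le hm0 (fun s => hsSq_nonneg (V j s)) hle
    (fun s => hn0 s.1) (by rw [sum_hsSq_eq_card h1, Fintype.card_fin])
    (hentν ▸ hent.trans hentμ) s with hs | hs
  · exact Or.inl (hsSq_eq_zero.mp hs)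
  · right
    have h' := hsSq_one_sub_le_of_unital h1 s
    rw [hs, Fintype.card_fin, sub_self] at h'
    exact (sub_eq_zero.mp (hsSq_eq_zero.mp (h'.antisymm (hsSq_nonneg _)))).symm

/-- Main theorem: a unital completely positive map `φ : A → B` between products of matrix
algebras is a homomorphism iff it is completely adjusted-entropy-nonincreasing, i.e. iff for
every `p ≥ 1` and every state `μ` on `B ⊗ M_p(ℂ)` (realized via Kronecker products),
`S̃(μ ∘ (φ ⊗ id)) ≤ S̃(μ)`. Here `Φ = φ ⊗ id` is quantified by its determining property on
elementary tensors, and the adjusted density operators of the two states are quantified by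
their determining properties. -/
theorem stmt_0 (ℓ ℓ' : ℕ) (hℓ : 0 < ℓ) (hℓ' : 0 < ℓ')
    (n : Fin ℓ → ℕ) (m : Fin ℓ' → ℕ) (hn : ∀ k, 0 < n k) (hm : ∀ j, 0 < m j)
    (φ : (∀ k, Matrix (Fin (n k)) (Fin (n k)) ℂ) →ₗ[ℂ] (∀ j, Matrix (Fin (m j)) (Fin (m j)) ℂ))
    (hφ1 : φ 1 = 1) (hφCP : IsCP φ) :
    (∀ a b, φ (a * b) = φ a * φ b) ↔
      (∀ p : ℕ, 0 < p →
        ∀ Φ : (∀ k, Matrix (Fin (n k) × Fin p) (Fin (n k) × Fin p) ℂ) →ₗ[ℂ]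
              (∀ j, Matrix (Fin (m j) × Fin p) (Fin (m j) × Fin p) ℂ),
          (∀ (a : ∀ k, Matrix (Fin (n k)) (Fin (n k)) ℂ) (c : Matrix (Fin p) (Fin p) ℂ),
            Φ (fun k => a k ⊗ₖ c) = fun j => φ a j ⊗ₖ c) →
        ∀ μ : (∀ j, Matrix (Fin (m j) × Fin p) (Fin (m j) × Fin p) ℂ) →ₗ[ℂ] ℂ,
          μ 1 = 1 → (∀ b, IsPos b → 0 ≤ μ b) →
        ∀ dν : ∀ k, Matrix (Fin (n k) × Fin p) (Fin (n k) × Fin p) ℂ,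
          IsPos dν → (∀ x, μ (Φ x) = atr (fun k => n k * p) (x * dν)) →
        ∀ dμ : ∀ j, Matrix (Fin (m j) × Fin p) (Fin (m j) × Fin p) ℂ,
          IsPos dμ → (∀ y, μ y = atr (fun j => m j * p) (y * dμ)) →
          adjEnt (fun k => n k * p) dν ≤ adjEnt (fun j => m j * p) dμ) := by
  have hne : ∀ k, Nonempty (Fin (n k)) := fun k => ⟨⟨0, hn k⟩⟩
  choose V hV horth using hφCP.exists_kraus
  have h1 : ∀ j, krausMap (I := fun k => Fin (n k))
      (R := fun k => Fin (n k) × Fin (m j)) (V j) 1 = 1 := fun j => by rw [← hV, hφ1, Pi.one_apply]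
  constructor
  · intro hmul p hp Φ hΦ μ _ _ dν _ hν dμ hdμ hμ
    have hiso : ∀ j s, V j s = 0 ∨ (V j s).conjTranspose * V j s = 1 := fun j =>
      isometry_of_krausMap_mul (fun x y => by rw [← hV, ← hV, ← hV, hmul, Pi.mul_apply])
        (h1 j) (horth j)
    have hΦeq : Φ = LinearMap.pi fun j => krausLinearMap (I := fun k => Fin (n k) × Fin p)
        (R := fun k => Fin (n k) × Fin (m j))
        (ampKraus (I := fun k => Fin (n k))
          (R := fun k => Fin (n k) × Fin (m j)) p (V j)) := by
      refine linearMap_eq_of_kronecker fun a c => ?_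
      rw [hΦ]
      funext j
      rw [hV]
      exact (krausMap_ampKraus_kronecker (I := fun k => Fin (n k))
        (R := fun k => Fin (n k) × Fin (m j)) p (V j) a c).symm
    have : ∀ k, Nonempty (Fin (n k) × Fin p) := fun k => ⟨⟨0, hn k⟩, ⟨0, hp⟩⟩
    have : ∀ j, Nonempty (Fin (m j) × Fin p) := fun j => ⟨⟨0, hm j⟩, ⟨0, hp⟩⟩
    have key := adjEnt_le_of_isometry (I := fun k => Fin (n k) × Fin p)
      (R := fun j k => Fin (n k) × Fin (m j))
      (V := fun j => ampKraus (I := fun k => Fin (n k))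
          (R := fun k => Fin (n k) × Fin (m j)) p (V j)) (dν := dν) (dμ := dμ)
      (fun j => krausMap_ampKraus_one (I := fun k => Fin (n k))
        (R := fun k => Fin (n k) × Fin (m j)) p (h1 j))
      (fun j s => ampKraus_isometry (I := fun k => Fin (n k))
        (R := fun k => Fin (n k) × Fin (m j)) p (hiso j s)) hdμ
    simp only [Fintype.card_prod, Fintype.card_fin] at key
    refine key fun x => ?_
    rw [← hν, ← hμ, hΦeq]
    rfl
  · intro h x y
    funext j
    have hiso := isometry_of_adjEnt_le hn hm j (h1 j) (horth j)
      (h (m j) (hm j) (LinearMap.pi fun j' => krausLinearMap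
        (I := fun k => Fin (n k) × Fin (m j)) (R := fun k => Fin (n k) × Fin (m j'))
        (ampKraus (I := fun k => Fin (n k))
          (R := fun k => Fin (n k) × Fin (m j')) (m j) (V j'))) fun a c => by
          funext j'
          rw [hV]
          exact krausMap_ampKraus_kronecker (I := fun k => Fin (n k))
            (R := fun k => Fin (n k) × Fin (m j')) (m j) (V j') a c)
    rw [Pi.mul_apply, hV, hV, hV]
    exact krausMap_mul_of_isometry (h1 j) hiso x y
end

section
/- Let A = M_{n_1}(ℂ) × ⋯ × M_{n_ℓ}(ℂ) and B = M_{m_1}(ℂ) × ⋯ × M_{m_{ℓ'}}(ℂ), let φ : A → B be a unital *-homomorphism, and let φ‡ : B → A be its adjusted adjoint. Then for every positive element b ∈ B, the element φ(φ‡(b)) − b is positive (i.e., φ(φ‡(b)) ≥ b). -/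
open scoped ComplexOrder
open Matrix in
theorem Matrix.posSemidef_of_forall_dotProduct_mulVec_nonneg {m : Type*} [Fintype m]
    (M : Matrix m m ℂ) (h : ∀ x : m → ℂ, 0 ≤ star x ⬝ᵥ M *ᵥ x) : M.PosSemidef := by
  classical
  rw [← Matrix.isPositive_toEuclideanLin_iff, LinearMap.isPositive_iff_complex]
  intro x
  have hx := h x.ofLp
  rw [Complex.nonneg_iff] at hx
  have key : inner ℂ (M.toEuclideanLin x) x = star (star x.ofLp ⬝ᵥ M *ᵥ x.ofLp) := by
    rw [EuclideanSpace.inner_eq_star_dotProduct, star_dotProduct, star_star, dotProduct_comm]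
    simp [Matrix.ofLp_toLpLin, dotProduct_comm]
  rw [key]
  refine ⟨?_, by simpa using hx.1⟩
  apply Complex.ext
  · simp
  · simpa using hx.2.symm

/-- A system of matrix units compatible with the conjugate transpose. -/
structure IsMatrixUnits {P m : Type*} [Fintype m] (F : P → P → Matrix m m ℂ) : Prop where
  mul_eq : ∀ p q r, F p q * F q r = F p r
  star_eq : ∀ p q, (F p q).conjTranspose = F q p

namespace IsMatrixUnits

open Matrix

variable {P m m' : Type*} [Fintype m] [Fintype m']
  {F : P → P → Matrix m m ℂ} {G : P → P → Matrix m' m' ℂ}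

theorem star_dotProduct_mulVec (hF : IsMatrixUnits F) (o p q : P) (v w : m → ℂ) :
    star w ⬝ᵥ F p q *ᵥ v = star (F o p *ᵥ w) ⬝ᵥ (F o q *ᵥ v) := by
  rw [star_mulVec, hF.star_eq, ← Matrix.dotProduct_mulVec, mulVec_mulVec, hF.mul_eq]

theorem trace_eq_trace (hF : IsMatrixUnits F) (p q : P) : (F p p).trace = (F q q).trace := by
  rw [← hF.mul_eq p q p, trace_mul_comm, hF.mul_eq]

theorem trace_eq_sum_norm_sq (hF : IsMatrixUnits F) (o : P) :
    (F o o).trace = ((∑ a, ∑ b, ‖F o o a b‖ ^ 2 : ℝ) : ℂ) := by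
  conv_lhs => rw [← hF.mul_eq o o o]
  simp only [trace, diag, mul_apply, Complex.ofReal_sum, Complex.ofReal_pow]
  refine Finset.sum_congr rfl fun a _ => Finset.sum_congr rfl fun b _ => ?_
  rw [← Complex.mul_conj']
  congr 1
  conv_lhs => rw [← hF.star_eq o o]
  simp

variable [Fintype P]

/-- The sum of squared entries of this matrix is computed in `sum_mul_eq`. -/
def crossMatrix (F : P → P → Matrix m m ℂ) (G : P → P → Matrix m' m' ℂ) (o : P)
    (v : m → ℂ) (w : m' → ℂ) : Matrix m m' ℂ :=
  ∑ p, vecMulVec (F o p *ᵥ v) (star (G o p *ᵥ w))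

theorem sum_mul_eq (hF : IsMatrixUnits F) (hG : IsMatrixUnits G) (o : P)
    (v : m → ℂ) (w : m' → ℂ) :
    ∑ p, ∑ q, (star v ⬝ᵥ F p q *ᵥ v) * (star w ⬝ᵥ G q p *ᵥ w) =
      ((∑ a, ∑ b, ‖crossMatrix F G o v w a b‖ ^ 2 : ℝ) : ℂ) := by
  have h : ∀ a b, ((‖crossMatrix F G o v w a b‖ ^ 2 : ℝ) : ℂ) =
      ∑ p, ∑ q, (star ((F o p *ᵥ v) a) * (F o q *ᵥ v) a) *
        (star ((G o q *ᵥ w) b) * (G o p *ᵥ w) b) := by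
    intro a b
    rw [Complex.ofReal_pow, ← Complex.conj_mul']
    simp only [crossMatrix, Matrix.sum_apply, vecMulVec_apply, Pi.star_apply, map_sum, map_mul,
      Finset.sum_mul_sum, RCLike.star_def, Complex.conj_conj]
    exact Finset.sum_congr rfl fun p _ => Finset.sum_congr rfl fun q _ => by ring
  rw [Complex.ofReal_sum]
  simp only [Complex.ofReal_sum, h]
  have h' : ∀ p q, (star v ⬝ᵥ F p q *ᵥ v) * (star w ⬝ᵥ G q p *ᵥ w) =
      ∑ a, ∑ b, (star ((F o p *ᵥ v) a) * (F o q *ᵥ v) a) *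
        (star ((G o q *ᵥ w) b) * (G o p *ᵥ w) b) := by
    intro p q
    rw [hF.star_dotProduct_mulVec o, hG.star_dotProduct_mulVec o]
    simp only [dotProduct, Pi.star_apply, Finset.sum_mul_sum]
  simp only [h']
  symm
  calc _ = ∑ a, ∑ p, ∑ b, ∑ q, (star ((F o p *ᵥ v) a) * (F o q *ᵥ v) a) *
        (star ((G o q *ᵥ w) b) * (G o p *ᵥ w) b) :=
        Finset.sum_congr rfl fun a _ => Finset.sum_comm
    _ = ∑ p, ∑ a, ∑ b, ∑ q, _ := Finset.sum_comm
    _ = ∑ p, ∑ a, ∑ q, ∑ b, _ :=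
        Finset.sum_congr rfl fun p _ => Finset.sum_congr rfl fun a _ => Finset.sum_comm
    _ = _ := Finset.sum_congr rfl fun p _ => Finset.sum_comm

theorem sum_mul_nonneg (hF : IsMatrixUnits F) (hG : IsMatrixUnits G) (o : P)
    (v : m → ℂ) (w : m' → ℂ) :
    0 ≤ ∑ p, ∑ q, (star v ⬝ᵥ F p q *ᵥ v) * (star w ⬝ᵥ G q p *ᵥ w) := by
  rw [hF.sum_mul_eq hG o, Complex.zero_le_real]
  positivity

theorem trace_mul_crossMatrix (hF : IsMatrixUnits F) (o : P) (v w : m → ℂ) :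
    (F o o * crossMatrix F F o v w).trace = ∑ p, star w ⬝ᵥ F p p *ᵥ v := by
  simp only [crossMatrix, Finset.mul_sum, mul_vecMulVec, mulVec_mulVec, hF.mul_eq, trace_sum,
    trace_vecMulVec]
  exact Finset.sum_congr rfl fun p _ => by
    rw [hF.star_dotProduct_mulVec o, dotProduct_comm]

end IsMatrixUnits

open Matrix in
theorem norm_sum_trace_mul_sq_le {ι m : Type*} [Fintype ι] [Fintype m]
    (c : ι → ℝ) (hc : ∀ k, 0 < c k) (S T : ι → Matrix m m ℂ) :
    ‖∑ k, (S k * T k).trace‖ ^ 2 ≤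
      (∑ k, c k * ∑ a, ∑ b, ‖S k a b‖ ^ 2) * ∑ k, (c k)⁻¹ * ∑ a, ∑ b, ‖T k a b‖ ^ 2 := by
  have hT : ∀ k, ∑ a, ∑ b, ‖T k a b‖ ^ 2 = ∑ a, ∑ b, ‖T k b a‖ ^ 2 :=
    fun k => Finset.sum_comm
  have h := Finset.sum_sq_le_sum_mul_sum_of_sq_le_mul (Finset.univ : Finset (ι × m × m))
    (r := fun x => ‖S x.1 x.2.1 x.2.2 * T x.1 x.2.2 x.2.1‖)
    (f := fun x => c x.1 * ‖S x.1 x.2.1 x.2.2‖ ^ 2)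
    (g := fun x => (c x.1)⁻¹ * ‖T x.1 x.2.2 x.2.1‖ ^ 2)
    (fun x _ => by have := hc x.1; positivity) (fun x _ => by have := hc x.1; positivity)
    (fun x _ => by have := (hc x.1).ne'; rw [norm_mul]; field_simp; exact le_rfl)
  simp only [Fintype.sum_prod_type, ← Finset.mul_sum] at h
  simp only [hT]
  refine le_trans ?_ h
  gcongr
  simp only [trace, diag, mul_apply]
  refine (norm_sum_le _ _).trans (Finset.sum_le_sum fun k _ => ?_)
  refine (norm_sum_le _ _).trans (Finset.sum_le_sum fun a _ => ?_)
  exact norm_sum_le _ _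

open Matrix in
/-- Cauchy-Schwarz inequality for a finite family of systems of matrix units which sum to `1`. -/
theorem IsMatrixUnits.mul_star_le {ι m : Type*} [Fintype ι] [Fintype m] [DecidableEq m]
    {P : ι → Type*} [∀ k, Fintype (P k)] (o : ∀ k, P k)
    {F : ∀ k, P k → P k → Matrix m m ℂ} (hF : ∀ k, IsMatrixUnits (F k))
    (hF1 : ∑ k, ∑ p, F k p p = 1) (v w : m → ℂ) :
    (star w ⬝ᵥ v) * (star v ⬝ᵥ w) ≤ (Fintype.card m : ℂ) *
      ∑ k, (Fintype.card (P k) : ℂ)⁻¹ *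
        ∑ p, ∑ q, (star v ⬝ᵥ F k p q *ᵥ v) * (star w ⬝ᵥ F k q p *ᵥ w) := by
  have hc : ∀ k, (0 : ℝ) < Fintype.card (P k) := fun k => by
    have : Nonempty (P k) := ⟨o k⟩
    exact_mod_cast Fintype.card_pos
  have h := norm_sum_trace_mul_sq_le (fun k => (Fintype.card (P k) : ℝ)) hc
    (fun k => F k (o k) (o k)) (fun k => IsMatrixUnits.crossMatrix (F k) (F k) (o k) v w)
  have h1 : ∑ k, (F k (o k) (o k) * IsMatrixUnits.crossMatrix (F k) (F k) (o k) v w).trace = star w ⬝ᵥ v := by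
    calc _ = ∑ k, ∑ p, star w ⬝ᵥ F k p p *ᵥ v :=
          Finset.sum_congr rfl fun k _ => (hF k).trace_mul_crossMatrix (o k) v w
      _ = star w ⬝ᵥ (∑ k, ∑ p, F k p p) *ᵥ v := by
          simp only [sum_mulVec, dotProduct_sum]
      _ = _ := by rw [hF1, one_mulVec]
  have h2 : ∑ k, (Fintype.card (P k) : ℝ) * ∑ a, ∑ b, ‖F k (o k) (o k) a b‖ ^ 2 =
      Fintype.card m := by
    have : ((∑ k, (Fintype.card (P k) : ℝ) * ∑ a, ∑ b, ‖F k (o k) (o k) a b‖ ^ 2 : ℝ) : ℂ) =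
        Fintype.card m := by
      rw [← trace_one (n := m) (R := ℂ), ← hF1, trace_sum, Complex.ofReal_sum]
      refine Finset.sum_congr rfl fun k _ => ?_
      rw [Complex.ofReal_mul, ← (hF k).trace_eq_sum_norm_sq, trace_sum,
        Finset.sum_congr rfl fun p _ => (hF k).trace_eq_trace p (o k)]
      simp
    exact_mod_cast this
  rw [h1, h2] at h
  have h3 : (star w ⬝ᵥ v) * (star v ⬝ᵥ w) = ((‖star w ⬝ᵥ v‖ ^ 2 : ℝ) : ℂ) := by
    rw [Complex.ofReal_pow, ← Complex.mul_conj', ← RCLike.star_def, star_dotProduct, star_star]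
  rw [h3, Finset.sum_congr rfl fun k _ => by rw [(hF k).sum_mul_eq (hF k) (o k)]]
  have h4 := Complex.real_le_real.2 h
  simpa only [Complex.ofReal_mul, Complex.ofReal_sum, Complex.ofReal_inv, Complex.ofReal_natCast]
    using h4

section BlockUnits

open Matrix

variable {ι : Type} [DecidableEq ι] {P : ι → Type} [∀ k, DecidableEq (P k)]

/-- The matrix unit `e_{pq}` of the `k`-th block of a product of matrix algebras. -/
def blockUnit (k : ι) (p q : P k) : ∀ k, Matrix (P k) (P k) ℂ :=
  Pi.single k (Matrix.single p q 1)

theorem star_blockUnit (k : ι) (p q : P k) : star (blockUnit k p q) = blockUnit k q p := by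
  rw [blockUnit, ← Pi.single_star, Matrix.star_eq_conjTranspose, Matrix.conjTranspose_single,
    star_one, blockUnit]

variable [∀ k, Fintype (P k)]

theorem blockUnit_mul (k : ι) (p q r : P k) :
    blockUnit k p q * blockUnit k q r = blockUnit k p r := by
  rw [blockUnit, blockUnit, ← Pi.single_mul, Matrix.single_mul_single_same, one_mul, blockUnit]

variable [Fintype ι]

theorem eq_sum_smul_blockUnit (x : ∀ k, Matrix (P k) (P k) ℂ) :
    x = ∑ k, ∑ p, ∑ q, x k q p • blockUnit k q p := by
  conv_lhs => rw [← Finset.univ_sum_single x]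
  refine Finset.sum_congr rfl fun k _ => ?_
  have h : ∀ p q, x k q p • (blockUnit k q p : ∀ k, Matrix (P k) (P k) ℂ) =
      Pi.single k (Matrix.single q p (x k q p)) := by
    intro p q
    rw [blockUnit, ← Pi.single_smul, Matrix.smul_single, smul_eq_mul, mul_one]
  simp only [h]
  conv_lhs => rw [Matrix.matrix_eq_sum_single (x k), Finset.sum_comm]
  rw [← AddMonoidHom.single_apply]
  simp only [map_sum, AddMonoidHom.single_apply]

theorem sum_blockUnit : ∑ k, ∑ p, blockUnit (P := P) k p p = 1 := by
  rw [eq_sum_smul_blockUnit (1 : ∀ k, Matrix (P k) (P k) ℂ)]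
  simp [Matrix.one_apply]

theorem atr_blockUnit_mul (w : ι → ℕ) (k : ι) (p q : P k) (x : ∀ k, Matrix (P k) (P k) ℂ) :
    atr w (blockUnit k p q * x) = w k * x k q p := by
  rw [atr, Finset.sum_eq_single k]
  · simp [blockUnit, Matrix.trace_single_mul]
  · intro i _ hi
    simp [blockUnit, Pi.single_eq_of_ne hi]
  · simp

end BlockUnits

open scoped Matrix

/-- Proposition N: if `φ` is a unital *-homomorphism, then `φ(φ‡(b)) ≥ b` for positive `b`. -/
theorem stmt_13 (ℓ ℓ' : ℕ) (hℓ : 0 < ℓ) (hℓ' : 0 < ℓ')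
    (n : Fin ℓ → ℕ) (m : Fin ℓ' → ℕ) (hn : ∀ k, 0 < n k) (hm : ∀ j, 0 < m j)
    (φ : (∀ k, Matrix (Fin (n k)) (Fin (n k)) ℂ) →ₗ[ℂ] (∀ j, Matrix (Fin (m j)) (Fin (m j)) ℂ))
    (hφ1 : φ 1 = 1)
    (hφmul : ∀ a b, φ (a * b) = φ a * φ b)
    (hφstar : ∀ a, φ (star a) = star (φ a))
    (ψ : (∀ j, Matrix (Fin (m j)) (Fin (m j)) ℂ) →ₗ[ℂ] (∀ k, Matrix (Fin (n k)) (Fin (n k)) ℂ))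
    (hψ : ∀ a b, atr m (φ a * b) = atr n (a * ψ b))
    (b : ∀ j, Matrix (Fin (m j)) (Fin (m j)) ℂ) (hb : IsPos b) :
    IsPos (φ (ψ b) - b) := by
  classical
  have hF : ∀ j k, IsMatrixUnits fun p q => φ (blockUnit k p q) j := fun j k =>
    { mul_eq := fun p q r => by rw [← Pi.mul_apply, ← hφmul, blockUnit_mul]
      star_eq := fun p q => by
        rw [← Matrix.star_eq_conjTranspose, ← Pi.star_apply, ← hφstar, star_blockUnit] }
  have hF1 : ∀ j, ∑ k, ∑ p, φ (blockUnit k p p) j = 1 := fun j => by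
    have h := congrFun hφ1 j
    rw [← sum_blockUnit] at h
    simp only [map_sum, Finset.sum_apply] at h
    exact h
  have hdec : ∀ j, ∃ (r : ℕ) (u : Fin r → Fin (m j) → ℂ),
      b j = ∑ c, Matrix.vecMulVec (u c) (star (u c)) :=
    fun j => Matrix.posSemidef_iff_eq_sum_vecMulVec.1 (hb j)
  choose r u hu using hdec
  have hψb : ∀ k p q, ψ b k q p =
      (n k : ℂ)⁻¹ * ∑ i, ∑ c, (m i : ℂ) * (star (u i c) ⬝ᵥ φ (blockUnit k p q) i *ᵥ u i c) := by
    intro k p q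
    have hk : (n k : ℂ) ≠ 0 := Nat.cast_ne_zero.2 (hn k).ne'
    rw [eq_inv_mul_iff_mul_eq₀ hk, ← atr_blockUnit_mul n k p q (ψ b), ← hψ, atr]
    refine Finset.sum_congr rfl fun i _ => ?_
    rw [Pi.mul_apply, hu i, Finset.mul_sum, Matrix.trace_sum, Finset.mul_sum]
    refine Finset.sum_congr rfl fun c _ => ?_
    rw [Matrix.mul_vecMulVec, Matrix.trace_vecMulVec, dotProduct_comm]
  intro j
  refine Matrix.posSemidef_of_forall_dotProduct_mulVec_nonneg _ fun w => ?_
  have hφψ : star w ⬝ᵥ φ (ψ b) j *ᵥ w = ∑ i, ∑ c, (m i : ℂ) * ∑ k, (n k : ℂ)⁻¹ * ∑ p, ∑ q,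
      (star (u i c) ⬝ᵥ φ (blockUnit k p q) i *ᵥ u i c) *
        (star w ⬝ᵥ φ (blockUnit k q p) j *ᵥ w) := by
    conv_lhs => rw [eq_sum_smul_blockUnit (ψ b)]
    simp only [map_sum, map_smul, Finset.sum_apply, Pi.smul_apply, Matrix.sum_mulVec,
      Matrix.smul_mulVec, dotProduct_sum, dotProduct_smul, smul_eq_mul, hψb]
    simp only [Finset.mul_sum, Finset.sum_mul]
    symm
    rw [Finset.sum_congr rfl fun i _ => Finset.sum_comm, Finset.sum_comm]
    refine Finset.sum_congr rfl fun k _ => ?_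
    rw [Finset.sum_congr rfl fun i _ => Finset.sum_comm, Finset.sum_comm]
    refine Finset.sum_congr rfl fun p _ => ?_
    rw [Finset.sum_congr rfl fun i _ => Finset.sum_comm, Finset.sum_comm]
    refine Finset.sum_congr rfl fun q _ => Finset.sum_congr rfl fun i _ =>
      Finset.sum_congr rfl fun c _ => by ring
  have hbw : star w ⬝ᵥ b j *ᵥ w = ∑ c, (star w ⬝ᵥ u j c) * (star (u j c) ⬝ᵥ w) := by
    rw [hu j, Matrix.sum_mulVec, dotProduct_sum]
    refine Finset.sum_congr rfl fun c _ => ?_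
    rw [Matrix.vecMulVec_mulVec, dotProduct_smul]
    simp
  rw [Pi.sub_apply, Matrix.sub_mulVec, dotProduct_sub, sub_nonneg, hφψ, hbw]
  have hnonneg : ∀ i c, 0 ≤ (m i : ℂ) * ∑ k, (n k : ℂ)⁻¹ * ∑ p, ∑ q,
      (star (u i c) ⬝ᵥ φ (blockUnit k p q) i *ᵥ u i c) *
        (star w ⬝ᵥ φ (blockUnit k q p) j *ᵥ w) := fun i c =>
    mul_nonneg (Nat.cast_nonneg _) <| Finset.sum_nonneg fun k _ =>
      mul_nonneg (inv_nonneg.2 (Nat.cast_nonneg _)) <|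
        (hF i k).sum_mul_nonneg (hF j k) ⟨0, hn k⟩ (u i c) w
  have hle := Finset.single_le_sum
    (fun i _ => Finset.sum_nonneg (s := Finset.univ) fun c _ => hnonneg i c) (Finset.mem_univ j)
  refine le_trans (Finset.sum_le_sum fun c _ => ?_) hle
  simpa only [Fintype.card_fin] using
    IsMatrixUnits.mul_star_le (fun k => ⟨0, hn k⟩) (hF j) (hF1 j) (u j c) w
end
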